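/- Let W ∈ ℝ^{r×r} be diagonal with W₁₁ ≥ W₂₂ ≥ ⋯ ≥ W_{rr} > 0, and let X ∈ ℝ^{m×n} with singular values σ₁ ≥ ⋯ ≥ σ_{rank(X)} > 0 and rank(X) ≤ r. Then for every A ∈ ℝ^{m×r} and B ∈ ℝ^{n×r} with A·Bᵀ = X, one has (1/2)(‖A·W^{-1}‖_F² + ‖B‖_F²) ≥ Σ_{i=1}^{rank(X)} σ_i / W_{ii}. -/

import Mathlib

open Matrix

/-- Squared Frobenius norm. -/
noncomputable def frobSq {m n : ℕ} (A : Matrix (Fin m) (Fin n) ℝ) : ℝ :=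
  ∑ i, ∑ j, (A i j) ^ 2

/-- Summation by parts: if all tail sums of `e` are nonnegative, then so is its pairing with any
nonnegative monotone sequence. -/
lemma sum_mul_nonneg_of_tail_sum_nonneg {r : ℕ} (d e : Fin r → ℝ) (hd : ∀ i, 0 ≤ d i)
    (hmono : Monotone d) (he : ∀ k : ℕ, 0 ≤ ∑ j : Fin r, if k ≤ (j : ℕ) then e j else 0) :
    0 ≤ ∑ j, d j * e j := by
  induction r with
  | zero => simp
  | succ r ih =>
    have h := ih (fun i => d i.succ - d 0) (fun i => e i.succ)
      (fun i => sub_nonneg.2 (hmono (Fin.zero_le _)))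
      (fun i j hij => sub_le_sub_right (hmono (Fin.succ_le_succ_iff.2 hij)) _)
      (fun k => by simpa [Fin.sum_univ_succ] using he (k + 1))
    have h0 := mul_nonneg (hd 0) (he 0)
    simp only [Fin.sum_univ_succ, zero_le, if_true] at h0 ⊢
    simp only [sub_mul, Finset.sum_sub_distrib, ← Finset.mul_sum] at h
    linarith

/-- Among weights in `[0, 1]` of total mass at least `s - k`, the pairing with an antitone
nonnegative sequence is at least the tail sum starting at index `k`. -/
lemma tail_sum_le_sum_mul {s : ℕ} (σ z : Fin s → ℝ) (hσ : ∀ i, 0 ≤ σ i) (hmono : Antitone σ)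
    (hz0 : ∀ i, 0 ≤ z i) (hz1 : ∀ i, z i ≤ 1) (k : ℕ) (hz : (s : ℝ) - k ≤ ∑ i, z i) :
    (∑ i : Fin s, if k ≤ (i : ℕ) then σ i else 0) ≤ ∑ i, σ i * z i := by
  rcases lt_or_ge k s with hk | hk
  · set t := σ ⟨k, hk⟩
    have hterm : ∀ i : Fin s, (if k ≤ (i : ℕ) then σ i - t else 0) ≤ (σ i - t) * z i := by
      intro i
      split_ifs with h
      · have : σ i ≤ t := hmono (show (⟨k, hk⟩ : Fin s) ≤ i from h)
        nlinarith [hz1 i]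
      · have : t ≤ σ i := hmono (show i ≤ (⟨k, hk⟩ : Fin s) from (not_le.1 h).le)
        exact mul_nonneg (sub_nonneg.2 this) (hz0 i)
    have hsum := Finset.sum_le_sum fun i (_ : i ∈ Finset.univ) => hterm i
    have hcard : (∑ i : Fin s, if k ≤ (i : ℕ) then t else 0) = t * ((s : ℝ) - k) := by
      have : (Finset.univ.filter fun i : Fin s => k ≤ (i : ℕ)) = Finset.Ici ⟨k, hk⟩ := by
        ext i; simp [Fin.le_def]
      rw [← Finset.sum_filter, this, Finset.sum_const, Fin.card_Ici, nsmul_eq_mul,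
        Nat.cast_sub hk.le, mul_comm]
    have hsplit : (∑ i : Fin s, if k ≤ (i : ℕ) then σ i - t else 0) =
        (∑ i : Fin s, if k ≤ (i : ℕ) then σ i else 0) -
          ∑ i : Fin s, if k ≤ (i : ℕ) then t else 0 := by
      rw [← Finset.sum_sub_distrib]
      exact Finset.sum_congr rfl fun i _ => by split_ifs <;> simp
    simp only [sub_mul, Finset.sum_sub_distrib, ← Finset.mul_sum] at hsum
    have := mul_le_mul_of_nonneg_left hz (hσ ⟨k, hk⟩)
    rw [hsplit, hcard] at hsum
    linarith
  · rw [Finset.sum_eq_zero fun i _ => if_neg (by omega)]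
    exact Finset.sum_nonneg fun i _ => mul_nonneg (hσ i) (hz0 i)

/-- Nuclear-norm form of the Eckart–Young inequality: if the rank-one matrices `p j (q j)ᵀ` sum to
`diagonal σ`, then the terms of index at least `k` have total mass at least the tail of `σ`. -/
lemma tail_sum_le_sum_norm_mul_norm {r s : ℕ} (σ : Fin s → ℝ) (hσ : ∀ i, 0 ≤ σ i)
    (hmono : Antitone σ) (p q : Fin r → EuclideanSpace ℝ (Fin s))
    (hpq : ∀ a b, ∑ j, p j a * q j b = if a = b then σ a else 0) (k : ℕ) :
    (∑ i : Fin s, if k ≤ (i : ℕ) then σ i else 0) ≤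
      ∑ j : Fin r, if k ≤ (j : ℕ) then ‖p j‖ * ‖q j‖ else 0 := by
  set S : Finset (Fin r) := Finset.univ.filter fun j => (j : ℕ) < k with hS
  set K : Submodule ℝ (EuclideanSpace ℝ (Fin s)) :=
    Submodule.span ℝ (S.image q : Set (EuclideanSpace ℝ (Fin s)))
  set Z := Kᗮ.starProjection
  set e := EuclideanSpace.basisFun (Fin s) ℝ with he
  have hKcard : Module.finrank ℝ K ≤ k := by
    refine (finrank_span_finset_le_card _).trans (Finset.card_image_le.trans ?_)
    have : S.card ≤ (Finset.range k).card :=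
      Finset.card_le_card_of_injOn (fun j => (j : ℕ)) (fun j hj => by simpa [hS] using hj)
        Fin.val_injective.injOn
    simpa using this
  have hZe : ∀ x, inner ℝ x (Z x) = ‖Z x‖ ^ 2 := fun x => by
    rw [real_inner_comm]
    exact Kᗮ.re_inner_starProjection_eq_normSq x
  have htrace : ∑ i, inner ℝ (e i) (Z (e i)) = (s : ℝ) - Module.finrank ℝ K := by
    have hproj : LinearMap.IsProj Kᗮ (Z : EuclideanSpace ℝ (Fin s) →ₗ[ℝ] _) :=
      ⟨fun x => Kᗮ.starProjection_apply_mem x,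
        fun x hx => Submodule.starProjection_eq_self_iff.2 hx⟩
    have hfin := K.finrank_add_finrank_orthogonal
    rw [finrank_euclideanSpace_fin] at hfin
    have htr := LinearMap.trace_eq_sum_inner (Z : EuclideanSpace ℝ (Fin s) →ₗ[ℝ] _) e
    rw [hproj.trace] at htr
    have hcast : (Module.finrank ℝ K : ℝ) + Module.finrank ℝ Kᗮ = s := by exact_mod_cast hfin
    simp only [ContinuousLinearMap.coe_coe] at htr
    linarith
  have hexp : ∑ i, σ i * inner ℝ (e i) (Z (e i)) = ∑ j, inner ℝ (p j) (Z (q j)) := by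
    have hinner : ∀ j, inner ℝ (p j) (Z (q j)) =
        ∑ a, ∑ b, p j a * q j b * inner ℝ (e a) (Z (e b)) := by
      intro j
      conv_lhs => rw [← e.sum_repr (p j), ← e.sum_repr (q j)]
      simp only [map_sum, map_smul, sum_inner, inner_sum, inner_smul_left, inner_smul_right]
      rw [Finset.sum_comm]
      simp [he, Finset.mul_sum, mul_assoc, mul_left_comm]
    simp only [hinner]
    rw [Finset.sum_comm]
    refine Finset.sum_congr rfl fun a _ => ?_
    rw [Finset.sum_comm]
    simp [← Finset.sum_mul, hpq]
  calc (∑ i : Fin s, if k ≤ (i : ℕ) then σ i else 0)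
      ≤ ∑ i, σ i * inner ℝ (e i) (Z (e i)) := by
        refine tail_sum_le_sum_mul σ _ hσ hmono (fun i => ?_) (fun i => ?_) k ?_
        · rw [hZe]; positivity
        · rw [hZe]
          have h1 := Kᗮ.norm_starProjection_apply_le (e i)
          rw [e.norm_eq_one] at h1
          exact pow_le_one₀ (norm_nonneg _) h1
        · rw [htrace]
          have : (Module.finrank ℝ K : ℝ) ≤ k := by exact_mod_cast hKcard
          linarith
    _ = ∑ j, inner ℝ (p j) (Z (q j)) := hexp
    _ ≤ _ := by
        refine Finset.sum_le_sum fun j _ => ?_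
        split_ifs with h
        · exact (real_inner_le_norm _ _).trans (mul_le_mul_of_nonneg_left
            (Kᗮ.norm_starProjection_apply_le _) (norm_nonneg _))
        · have hq : q j ∈ K := Submodule.subset_span (by
            simpa using ⟨j, by simpa [hS] using h, rfl⟩)
          have : Z (q j) = 0 :=
            (Submodule.starProjection_apply_eq_zero_iff _).2 (K.le_orthogonal_orthogonal hq)
          rw [this, inner_zero_right]

/-- Bessel's inequality for the columns of a matrix with orthonormal columns. -/
lemma sum_sq_transpose_mulVec_le {m s : ℕ} (U : Matrix (Fin m) (Fin s) ℝ) (hU : Uᵀ * U = 1)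
    (x : Fin m → ℝ) : ∑ i, (Uᵀ *ᵥ x) i ^ 2 ≤ ∑ i, x i ^ 2 := by
  have h1 : x ⬝ᵥ (U *ᵥ (Uᵀ *ᵥ x)) = (Uᵀ *ᵥ x) ⬝ᵥ (Uᵀ *ᵥ x) := by
    rw [dotProduct_mulVec, ← mulVec_transpose]
  have h2 : (U *ᵥ (Uᵀ *ᵥ x)) ⬝ᵥ (U *ᵥ (Uᵀ *ᵥ x)) = (Uᵀ *ᵥ x) ⬝ᵥ (Uᵀ *ᵥ x) := by
    rw [dotProduct_mulVec, ← mulVec_transpose, mulVec_mulVec, hU, one_mulVec]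
  have h0 : 0 ≤ (x - U *ᵥ (Uᵀ *ᵥ x)) ⬝ᵥ (x - U *ᵥ (Uᵀ *ᵥ x)) :=
    Finset.sum_nonneg fun i _ => mul_self_nonneg _
  rw [sub_dotProduct, dotProduct_sub, dotProduct_sub, h2, h1, dotProduct_comm (U *ᵥ _) x, h1] at h0
  simp only [dotProduct, ← sq] at h0
  linarith

/-- For `W = diag w` (`r × r`, nonincreasing positive) and `X` of rank `s ≤ r` with
reduced SVD `X = U (diag σ) Vᵀ`, every factorization `X = A Bᵀ` satisfies
`(1/2)(‖A W⁻¹‖_F² + ‖B‖_F²) ≥ ∑ᵢ σᵢ / Wᵢᵢ`. -/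
theorem stmt15 {m n r s : ℕ}
    (w : Fin r → ℝ) (hw_pos : ∀ i, 0 < w i) (hw_mono : Antitone w)
    (X : Matrix (Fin m) (Fin n) ℝ) (hrank : X.rank = s) (hsr : s ≤ r)
    (U : Matrix (Fin m) (Fin s) ℝ) (V : Matrix (Fin n) (Fin s) ℝ)
    (hU : Uᵀ * U = 1) (hV : Vᵀ * V = 1)
    (σ : Fin s → ℝ) (hσ_pos : ∀ i, 0 < σ i) (hσ_mono : Antitone σ)
    (hX : X = U * Matrix.diagonal σ * Vᵀ)
    (A : Matrix (Fin m) (Fin r) ℝ) (B : Matrix (Fin n) (Fin r) ℝ)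
    (hAB : A * Bᵀ = X) :
    (1/2) * (frobSq (A * (Matrix.diagonal w)⁻¹) + frobSq B) ≥
      ∑ i, σ i / w (Fin.castLE hsr i) := by
  set p : Fin r → EuclideanSpace ℝ (Fin s) := fun j => WithLp.toLp 2 (Uᵀ *ᵥ A.col j)
  set q : Fin r → EuclideanSpace ℝ (Fin s) := fun j => WithLp.toLp 2 (Vᵀ *ᵥ B.col j)
  have hPQ : (Uᵀ * A) * (Vᵀ * B)ᵀ = Matrix.diagonal σ := by
    calc (Uᵀ * A) * (Vᵀ * B)ᵀ = Uᵀ * (A * Bᵀ) * V := by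
          simp only [transpose_mul, transpose_transpose, Matrix.mul_assoc]
      _ = (Uᵀ * U) * Matrix.diagonal σ * (Vᵀ * V) := by
          rw [hAB, hX]; simp only [Matrix.mul_assoc]
      _ = Matrix.diagonal σ := by rw [hU, hV, Matrix.one_mul, Matrix.mul_one]
  have hpq : ∀ a b, ∑ j, p j a * q j b = if a = b then σ a else 0 := fun a b => by
    rw [← Matrix.diagonal_apply, ← hPQ]
    rfl
  have htail := tail_sum_le_sum_norm_mul_norm σ (fun i => (hσ_pos i).le) hσ_mono p q hpq
  have hpn : ∀ j, ‖p j‖ ^ 2 ≤ ∑ i, A i j ^ 2 := fun j => by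
    rw [EuclideanSpace.real_norm_sq_eq]
    exact sum_sq_transpose_mulVec_le U hU _
  have hqn : ∀ j, ‖q j‖ ^ 2 ≤ ∑ i, B i j ^ 2 := fun j => by
    rw [EuclideanSpace.real_norm_sq_eq]
    exact sum_sq_transpose_mulVec_le V hV _
  set b : Fin r → ℝ := fun j => if h : (j : ℕ) < s then σ ⟨j, h⟩ else 0 with hb
  have hsum : ∀ f : Fin r → ℝ, (∀ j : Fin r, s ≤ (j : ℕ) → f j = 0) →
      ∑ j, f j = ∑ i : Fin s, f (Fin.castLE hsr i) := by
    intro f hf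
    obtain ⟨t, rfl⟩ := Nat.exists_eq_add_of_le hsr
    rw [Fin.sum_univ_add]
    simp [hf, Fin.castAdd]
  have hbi : ∀ i : Fin s, b (Fin.castLE hsr i) = σ i := fun i => by simp [hb]
  have hb0 : ∀ j : Fin r, s ≤ (j : ℕ) → b j = 0 := fun j hj => by simp [hb, hj]
  have habel := sum_mul_nonneg_of_tail_sum_nonneg (fun j => (w j)⁻¹)
    (fun j => ‖p j‖ * ‖q j‖ - b j) (fun j => inv_nonneg.2 (hw_pos j).le)
    (fun i j hij => inv_anti₀ (hw_pos j) (hw_mono hij)) (fun k => by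
      have h1 := hsum (fun j => if k ≤ (j : ℕ) then b j else 0) (fun j hj => by simp [hb0 j hj])
      simp only [hbi, Fin.val_castLE] at h1
      have h2 := htail k
      rw [← h1, ← sub_nonneg, ← Finset.sum_sub_distrib] at h2
      refine h2.trans_eq (Finset.sum_congr rfl fun j _ => ?_)
      split_ifs <;> simp)
  have hlhs : ∑ i, σ i / w (Fin.castLE hsr i) = ∑ j, (w j)⁻¹ * b j := by
    rw [hsum _ fun j hj => by rw [hb0 j hj, mul_zero]]
    simp only [hbi, div_eq_inv_mul]
  have hinv : (Matrix.diagonal w)⁻¹ = Matrix.diagonal fun j => (w j)⁻¹ := by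
    refine Matrix.inv_eq_right_inv ?_
    rw [Matrix.diagonal_mul_diagonal, ← Matrix.diagonal_one]
    congr 1
    funext j
    exact mul_inv_cancel₀ (hw_pos j).ne'
  have hA : frobSq (A * (Matrix.diagonal w)⁻¹) = ∑ j, (w j)⁻¹ ^ 2 * ∑ i, A i j ^ 2 := by
    rw [hinv, frobSq, Finset.sum_comm]
    simp only [Matrix.mul_diagonal, mul_pow, Finset.mul_sum, mul_comm]
  have hB : frobSq B = ∑ j, ∑ i, B i j ^ 2 := Finset.sum_comm
  have hamgm : ∑ j, (w j)⁻¹ * (‖p j‖ * ‖q j‖) ≤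
      ∑ j, (1 / 2) * ((w j)⁻¹ ^ 2 * ∑ i, A i j ^ 2 + ∑ i, B i j ^ 2) := by
    refine Finset.sum_le_sum fun j _ => ?_
    have h1 := mul_le_mul_of_nonneg_left (hpn j) (sq_nonneg (w j)⁻¹)
    nlinarith [hqn j, sq_nonneg ((w j)⁻¹ * ‖p j‖ - ‖q j‖)]
  rw [← Finset.mul_sum, Finset.sum_add_distrib, ← hA, ← hB] at hamgm
  simp only [mul_sub, Finset.sum_sub_distrib] at habel
  rw [hlhs]
  linarith
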